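/- (Quantitative quantum de Finetti theorem.) There exists a universal constant C' > 0 such that for all integers d ≥ 2 and K ≥ 3 the following holds. Let Γ be a complex matrix indexed by (Fin K → Fin d) × (Fin K → Fin d) that is positive semidefinite, has trace 1, and is permutation-symmetric, i.e. Γ(x∘σ, y∘σ) = Γ(x, y) for every permutation σ of Fin K and all x, y : Fin K → Fin d. Define the 3-body reduced density matrix Γ^{(3)}, indexed by (Fin 3 → Fin d) × (Fin 3 → Fin d), by Γ^{(3)}(a, b) = Σ_{c : Fin (K−3) → Fin d} Γ(a⌢c, b⌢c), where ⌢ denotes concatenation of index tuples. Then there exists a probability measure μ supported on the set of d×d complex positive semidefinite matrices of trace 1 such that for all Hermitian d×d complex matrices A, B, C: |Tr( (A ⊗ B ⊗ C) · (Γ^{(3)} − ∫ γ ⊗ γ ⊗ γ dμ(γ)) )| ≤ C' √((log d)/K) · ‖A‖ ‖B‖ ‖C‖, where ⊗ denotes the Kronecker (tensor) product of matrices and ‖·‖ the ℓ² → ℓ² operator norm. -/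

import Mathlib

open MeasureTheory
open scoped Topology ComplexOrder

noncomputable section

/-- Kronecker (tensor) product `A ⊗ B ⊗ C` of three `d×d` matrices, realised as a matrix
indexed by triples of indices. -/
def trip {d : ℕ} (A B C : Matrix (Fin d) (Fin d) ℂ) :
    Matrix (Fin 3 → Fin d) (Fin 3 → Fin d) ℂ :=
  Matrix.of fun x y => A (x 0) (y 0) * B (x 1) (y 1) * C (x 2) (y 2)

/-- Concatenation `a ⌢ c : Fin K → Fin d` of a `3`-tuple and a `(K−3)`-tuple. -/
def app3 {d K : ℕ} (hK : 3 ≤ K) (a : Fin 3 → Fin d) (c : Fin (K - 3) → Fin d) :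
    Fin K → Fin d :=
  fun i => Fin.append a c (Fin.cast (by omega) i)

/-- The 3-body reduced density matrix `Γ^{(3)}` of a `K`-body state `Γ`. -/
def red3 {d K : ℕ} (hK : 3 ≤ K) (Γ : Matrix (Fin K → Fin d) (Fin K → Fin d) ℂ) :
    Matrix (Fin 3 → Fin d) (Fin 3 → Fin d) ℂ :=
  Matrix.of fun a b => ∑ c : Fin (K - 3) → Fin d, Γ (app3 hK a c) (app3 hK b c)

/-- The `ℓ² → ℓ²` operator norm of a `d×d` complex matrix. -/
def l2OpNorm {d : ℕ} (A : Matrix (Fin d) (Fin d) ℂ) : ℝ :=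
  ‖LinearMap.toContinuousLinearMap (Matrix.toEuclideanLin A)‖

namespace QuantumDeFinetti

open Matrix

section Entropy

variable {n : Type*} [Fintype n]

/-- Rescaling of a matrix to unit trace (zero if the trace vanishes). -/
def normalize (X : Matrix n n ℂ) : Matrix n n ℂ := X.trace.re⁻¹ • X

lemma re_trace_nonneg {X : Matrix n n ℂ} (hX : X.PosSemidef) : 0 ≤ X.trace.re :=
  (Complex.nonneg_iff.mp hX.trace_nonneg).1

lemma ofReal_re_trace {X : Matrix n n ℂ} (hX : X.PosSemidef) : (X.trace.re : ℂ) = X.trace :=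
  Complex.ext rfl (Complex.nonneg_iff.mp hX.trace_nonneg).2

lemma eq_zero_of_re_trace {X : Matrix n n ℂ} (hX : X.PosSemidef) (h : X.trace.re = 0) :
    X = 0 := by
  rw [← hX.trace_eq_zero_iff, ← ofReal_re_trace hX, h, Complex.ofReal_zero]

lemma smul_normalize {X : Matrix n n ℂ} (hX : X.PosSemidef) :
    X.trace.re • normalize X = X := by
  by_cases h : X.trace.re = 0
  · rw [h, zero_smul, eq_zero_of_re_trace hX h]
  · rw [normalize, smul_smul, mul_inv_cancel₀ h, one_smul]

lemma posSemidef_normalize {X : Matrix n n ℂ} (hX : X.PosSemidef) :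
    (normalize X).PosSemidef :=
  hX.smul (inv_nonneg.mpr (re_trace_nonneg hX))

lemma trace_normalize {X : Matrix n n ℂ} (hX : X.PosSemidef) (h : X.trace.re ≠ 0) :
    (normalize X).trace = 1 := by
  rw [normalize, trace_smul, Complex.real_smul, ← ofReal_re_trace hX, Complex.ofReal_re,
    ← Complex.ofReal_mul, inv_mul_cancel₀ h, Complex.ofReal_one]

variable [DecidableEq n]

/-- The Hermitian matrix with eigenbasis the columns of `U` and eigenvalues `f`. -/
def conjDiag (U : Matrix n n ℂ) (f : n → ℝ) : Matrix n n ℂ :=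
  U * diagonal (fun i => (f i : ℂ)) * Uᴴ

lemma trace_mul_conjDiag (A U : Matrix n n ℂ) (f : n → ℝ) :
    (A * conjDiag U f).trace = ∑ i, (f i : ℂ) * (Uᴴ * A * U) i i := by
  have : (A * conjDiag U f).trace = ((Uᴴ * A * U) * diagonal (fun i => (f i : ℂ))).trace := by
    rw [conjDiag, ← Matrix.mul_assoc, Matrix.trace_mul_comm]
    simp only [Matrix.mul_assoc]
  rw [this, Matrix.trace]
  simp [Matrix.mul_diagonal, mul_comm]

lemma sum_row_normSq_le {A : Matrix n n ℂ} (h : (1 - A * Aᴴ).PosSemidef) (i : n) :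
    ∑ j, ‖A i j‖ ^ 2 ≤ 1 := by
  have h1 := h.diag_nonneg (i := i)
  have h2 : (1 - A * Aᴴ) i i = ((1 - ∑ j, ‖A i j‖ ^ 2 : ℝ) : ℂ) := by
    simp [Matrix.mul_apply, Complex.mul_conj, Complex.normSq_eq_norm_sq]
  rw [h2, Complex.zero_le_real] at h1
  linarith

lemma sum_row_normSq_eq {A : Matrix n n ℂ} (h : A * Aᴴ = 1) (i : n) :
    ∑ j, ‖A i j‖ ^ 2 = 1 := by
  have h2 : (A * Aᴴ) i i = ((∑ j, ‖A i j‖ ^ 2 : ℝ) : ℂ) := by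
    simp [Matrix.mul_apply, Complex.mul_conj, Complex.normSq_eq_norm_sq]
  rw [h, one_apply_eq] at h2
  exact_mod_cast h2.symm

lemma sq_sub_le_mul_bregman {a b : ℝ} (ha : 0 < a) (hb : 0 < b) :
    (a - b) ^ 2 ≤ 2 * (a + b) * (a * Real.log a - a * Real.log b - a + b) := by
  obtain ⟨x, hx, rfl⟩ : ∃ x : ℝ, 0 < x ∧ x ^ 2 = a := ⟨√a, by positivity, Real.sq_sqrt ha.le⟩
  obtain ⟨y, hy, rfl⟩ : ∃ x : ℝ, 0 < x ∧ x ^ 2 = b := ⟨√b, by positivity, Real.sq_sqrt hb.le⟩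
  have h1 : Real.log (y / x) ≤ y / x - 1 := Real.log_le_sub_one_of_pos (by positivity)
  rw [Real.log_div hy.ne' hx.ne'] at h1
  have h2 : x ^ 2 * (Real.log y - Real.log x) ≤ x * y - x ^ 2 := by
    calc _ ≤ x ^ 2 * (y / x - 1) := by gcongr
      _ = _ := by field_simp
  have h3 : (x - y) ^ 2 ≤
      x ^ 2 * Real.log (x ^ 2) - x ^ 2 * Real.log (y ^ 2) - x ^ 2 + y ^ 2 := by
    rw [Real.log_pow, Real.log_pow]
    push_cast
    nlinarith
  calc (x ^ 2 - y ^ 2) ^ 2 = (x + y) ^ 2 * (x - y) ^ 2 := by ring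
    _ ≤ 2 * (x ^ 2 + y ^ 2) * (x - y) ^ 2 := by
      gcongr
      nlinarith [sq_nonneg (x - y)]
    _ ≤ _ := by gcongr

/-- A Pinsker-type form of Klein's inequality. -/
lemma klein_pinsker {U V A : Matrix n n ℂ} (hU : U * Uᴴ = 1) (hV : V * Vᴴ = 1)
    {f g : n → ℝ} (hf : ∀ i, 0 < f i) (hg : ∀ i, 0 < g i)
    (hA : A.IsHermitian) (hA1 : (1 - A * A).PosSemidef) :
    ‖(A * (conjDiag V f - conjDiag U g)).trace‖ ^ 2 ≤
      2 * (∑ i, f i + ∑ i, g i) *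
        (∑ i, f i * Real.log (f i)
          - (conjDiag V f * conjDiag U (fun i => Real.log (g i))).trace.re
          - ∑ i, f i + ∑ i, g i) := by
  have hU' : Uᴴ * U = 1 := mul_eq_one_comm.mp hU
  have hV' : Vᴴ * V = 1 := mul_eq_one_comm.mp hV
  set M : Matrix n n ℂ := Uᴴ * V with hM
  set N : Matrix n n ℂ := Vᴴ * A * U with hN
  have hMH : Mᴴ = Vᴴ * U := by simp [hM]
  have hM1 : M * Mᴴ = 1 := by
    rw [hMH, hM, Matrix.mul_assoc, ← Matrix.mul_assoc V, hV, Matrix.one_mul, hU']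
  have hM2 : Mᴴ * M = 1 := mul_eq_one_comm.mp hM1
  have hNH : Nᴴ = Uᴴ * A * V := by simp [hN, hA.eq, Matrix.mul_assoc]
  have hrow : ∀ i, ∑ j, ‖M i j‖ ^ 2 = 1 := sum_row_normSq_eq hM1
  have hcol : ∀ j, ∑ i, ‖M i j‖ ^ 2 = 1 := fun j => by
    have := sum_row_normSq_eq (A := Mᴴ) (by simpa using hM2) j
    simpa using this
  have hNN : N * Nᴴ = Vᴴ * (A * A) * V := by
    rw [hNH, hN]
    calc Vᴴ * A * U * (Uᴴ * A * V) = Vᴴ * A * (U * Uᴴ) * A * V := by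
          simp only [Matrix.mul_assoc]
      _ = _ := by rw [hU]; simp only [Matrix.mul_assoc, Matrix.one_mul]
  have hNN' : Nᴴ * N = Uᴴ * (A * A) * U := by
    rw [hNH, hN]
    calc Uᴴ * A * V * (Vᴴ * A * U) = Uᴴ * A * (V * Vᴴ) * A * U := by
          simp only [Matrix.mul_assoc]
      _ = _ := by rw [hV]; simp only [Matrix.mul_assoc, Matrix.one_mul]
  have hNrow : ∀ j, ∑ i, ‖N j i‖ ^ 2 ≤ 1 := fun j => by
    refine sum_row_normSq_le (A := N) ?_ j
    have := hA1.conjTranspose_mul_mul_same V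
    rwa [Matrix.mul_sub, Matrix.sub_mul, Matrix.mul_one, hV', ← hNN] at this
  have hNcol : ∀ i, ∑ j, ‖N j i‖ ^ 2 ≤ 1 := fun i => by
    have h := sum_row_normSq_le (A := Nᴴ) (by
      have := hA1.conjTranspose_mul_mul_same U
      rwa [Matrix.mul_sub, Matrix.sub_mul, Matrix.mul_one, hU', ← hNN',
        ← conjTranspose_conjTranspose N, conjTranspose_conjTranspose Nᴴ] at this) i
    simpa using h
  have e1 : (A * conjDiag V f).trace = ∑ j, ∑ i, (f j : ℂ) * (N j i * M i j) := by
    rw [trace_mul_conjDiag]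
    refine Finset.sum_congr rfl fun j _ => ?_
    have : Vᴴ * A * V = N * M := by
      rw [hN, hM]
      calc Vᴴ * A * V = Vᴴ * A * (U * Uᴴ) * V := by rw [hU, Matrix.mul_one]
        _ = _ := by simp only [Matrix.mul_assoc]
    rw [this, Matrix.mul_apply, Finset.mul_sum]
  have e2 : (A * conjDiag U g).trace = ∑ j, ∑ i, (g i : ℂ) * (N j i * M i j) := by
    rw [trace_mul_conjDiag, Finset.sum_comm]
    refine Finset.sum_congr rfl fun i _ => ?_
    have : Uᴴ * A * U = M * N := by
      rw [hN, hM]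
      calc Uᴴ * A * U = Uᴴ * (V * Vᴴ) * A * U := by rw [hV, Matrix.mul_one]
        _ = _ := by simp only [Matrix.mul_assoc]
    rw [this, Matrix.mul_apply, Finset.mul_sum]
    simp only [mul_comm (M i _)]
  have e3 : (conjDiag V f * conjDiag U (fun i => Real.log (g i))).trace.re =
      ∑ j, ∑ i, f j * Real.log (g i) * ‖M i j‖ ^ 2 := by
    have h : (conjDiag V f * conjDiag U (fun i => Real.log (g i))).trace =
        ((∑ j, ∑ i, f j * Real.log (g i) * ‖M i j‖ ^ 2 : ℝ) : ℂ) := by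
      rw [trace_mul_conjDiag, Finset.sum_comm]
      push_cast
      refine Finset.sum_congr rfl fun i _ => ?_
      have : Uᴴ * conjDiag V f * U = M * diagonal (fun i => (f i : ℂ)) * Mᴴ := by
        rw [hMH, hM, conjDiag]
        simp only [Matrix.mul_assoc]
      rw [this, Matrix.mul_apply, Finset.mul_sum]
      refine Finset.sum_congr rfl fun j _ => ?_
      have h3 : M i j * star (M i j) = (‖M i j‖ : ℂ) ^ 2 := by
        rw [RCLike.star_def, Complex.mul_conj, Complex.normSq_eq_norm_sq]
        push_cast
        rfl
      rw [Matrix.mul_diagonal, conjTranspose_apply, ← h3]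
      ring
    rw [h, Complex.ofReal_re]
  have e4 : ∑ i, f i * Real.log (f i) =
      ∑ j, ∑ i, f j * Real.log (f j) * ‖M i j‖ ^ 2 := by
    simp only [← Finset.mul_sum, hcol, mul_one]
  have e5 : ∑ i, f i = ∑ j, ∑ i, f j * ‖M i j‖ ^ 2 := by
    simp only [← Finset.mul_sum, hcol, mul_one]
  have e6 : ∑ i, g i = ∑ j, ∑ i, g i * ‖M i j‖ ^ 2 := by
    rw [Finset.sum_comm]
    simp only [← Finset.mul_sum, hrow, mul_one]
  have hD : ∑ i, f i * Real.log (f i)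
          - (conjDiag V f * conjDiag U (fun i => Real.log (g i))).trace.re
          - ∑ i, f i + ∑ i, g i =
      ∑ p : n × n, (f p.1 * Real.log (f p.1) - f p.1 * Real.log (g p.2) - f p.1 + g p.2) *
        ‖M p.2 p.1‖ ^ 2 := by
    rw [e3, e4, e5, e6, Fintype.sum_prod_type]
    simp only [← Finset.sum_sub_distrib, ← Finset.sum_add_distrib]
    refine Finset.sum_congr rfl fun j _ => Finset.sum_congr rfl fun i _ => ?_
    ring
  have hN2 : ∑ p : n × n, (f p.1 + g p.2) * ‖N p.1 p.2‖ ^ 2 ≤ ∑ i, f i + ∑ i, g i := by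
    simp only [add_mul, Finset.sum_add_distrib]
    refine add_le_add ?_ ?_
    · rw [Fintype.sum_prod_type]
      refine Finset.sum_le_sum fun j _ => ?_
      dsimp only
      rw [← Finset.mul_sum]
      exact mul_le_of_le_one_right (hf j).le (hNrow j)
    · rw [Fintype.sum_prod_type_right]
      refine Finset.sum_le_sum fun i _ => ?_
      dsimp only
      rw [← Finset.mul_sum]
      exact mul_le_of_le_one_right (hg i).le (hNcol i)
  have hT : ‖(A * (conjDiag V f - conjDiag U g)).trace‖ ≤
      ∑ p : n × n, |f p.1 - g p.2| * (‖N p.1 p.2‖ * ‖M p.2 p.1‖) := by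
    rw [Matrix.mul_sub, trace_sub, e1, e2, ← Finset.sum_sub_distrib, Fintype.sum_prod_type]
    refine (norm_sum_le _ _).trans (Finset.sum_le_sum fun j _ => ?_)
    rw [← Finset.sum_sub_distrib]
    refine (norm_sum_le _ _).trans (Finset.sum_le_sum fun i _ => ?_)
    rw [← sub_mul, norm_mul, norm_mul, ← Complex.ofReal_sub, Complex.norm_real, Real.norm_eq_abs]
  have hDpos : ∀ p : n × n, 0 ≤
      f p.1 * Real.log (f p.1) - f p.1 * Real.log (g p.2) - f p.1 + g p.2 := fun p => by
    have h1 := sq_sub_le_mul_bregman (hf p.1) (hg p.2)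
    have h2 : 0 < 2 * (f p.1 + g p.2) := by have := hf p.1; have := hg p.2; positivity
    exact nonneg_of_mul_nonneg_right ((sq_nonneg _).trans h1) h2
  calc _ ≤ (∑ p : n × n, |f p.1 - g p.2| * (‖N p.1 p.2‖ * ‖M p.2 p.1‖)) ^ 2 := by gcongr
    _ ≤ (∑ p : n × n, (f p.1 + g p.2) * ‖N p.1 p.2‖ ^ 2) *
        ∑ p : n × n, 2 * ((f p.1 * Real.log (f p.1) - f p.1 * Real.log (g p.2) - f p.1 + g p.2) *
          ‖M p.2 p.1‖ ^ 2) := by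
      refine Finset.sum_sq_le_sum_mul_sum_of_sq_le_mul _ (fun p _ => ?_) (fun p _ => ?_)
        (fun p _ => ?_)
      · have := hf p.1
        have := hg p.2
        positivity
      · have := hDpos p
        positivity
      · rw [mul_pow, sq_abs, mul_pow]
        calc _ ≤ (2 * (f p.1 + g p.2) *
              (f p.1 * Real.log (f p.1) - f p.1 * Real.log (g p.2) - f p.1 + g p.2)) *
              (‖N p.1 p.2‖ ^ 2 * ‖M p.2 p.1‖ ^ 2) := by
                gcongr
                exact sq_sub_le_mul_bregman (hf p.1) (hg p.2)
          _ = _ := by ring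
    _ ≤ _ := by
      rw [hD, ← Finset.mul_sum, ← mul_assoc, mul_comm _ (2 : ℝ)]
      have : 0 ≤ ∑ p : n × n, (f p.1 * Real.log (f p.1) - f p.1 * Real.log (g p.2) - f p.1 + g p.2)
          * ‖M p.2 p.1‖ ^ 2 := Finset.sum_nonneg fun p _ => by have := hDpos p; positivity
      gcongr

/-- The negative entropy of `ρ + 1 / card n`; the shift keeps all eigenvalues positive. -/
def shiftedNegEntropy (ρ : Matrix n n ℂ) : ℝ :=
  if h : ρ.IsHermitian then
    ∑ i, (h.eigenvalues i + (Fintype.card n : ℝ)⁻¹) *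
      Real.log (h.eigenvalues i + (Fintype.card n : ℝ)⁻¹)
  else 0

/-- The extension of `shiftedNegEntropy` to positive matrices, homogeneous of degree one. -/
def homNegEntropy (X : Matrix n n ℂ) : ℝ := X.trace.re * shiftedNegEntropy (normalize X)

lemma trace_conjDiag_mul_conjDiag {U : Matrix n n ℂ} (hU : U * Uᴴ = 1) (f g : n → ℝ) :
    (conjDiag U f * conjDiag U g).trace = ((∑ i, f i * g i : ℝ) : ℂ) := by
  have hU' : Uᴴ * U = 1 := mul_eq_one_comm.mp hU
  have : Uᴴ * conjDiag U f * U = diagonal (fun i => (f i : ℂ)) := by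
    calc _ = (Uᴴ * U) * diagonal (fun i => (f i : ℂ)) * (Uᴴ * U) := by
          simp only [conjDiag, Matrix.mul_assoc]
      _ = _ := by rw [hU', Matrix.one_mul, Matrix.mul_one]
  rw [trace_mul_conjDiag, this]
  push_cast
  exact Finset.sum_congr rfl fun i _ => by rw [diagonal_apply_eq, mul_comm]

lemma exists_shifted_eq_conjDiag {ρ : Matrix n n ℂ} (hρ : ρ.PosSemidef) (h1 : ρ.trace = 1) :
    ∃ (U : Matrix n n ℂ) (f : n → ℝ), U * Uᴴ = 1 ∧
      (∀ i, (Fintype.card n : ℝ)⁻¹ ≤ f i) ∧ (∀ i, 0 < f i) ∧ (∀ i, f i ≤ 2) ∧ ∑ i, f i = 2 ∧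
      ρ + (Fintype.card n : ℝ)⁻¹ • 1 = conjDiag U f ∧
      shiftedNegEntropy ρ = ∑ i, f i * Real.log (f i) := by
  have hn : Nonempty n := by
    by_contra hn
    rw [not_nonempty_iff] at hn
    simp [Matrix.trace] at h1
  have hc : (1 : ℝ) ≤ Fintype.card n := by exact_mod_cast Fintype.card_pos
  have hc0 : (0 : ℝ) < (Fintype.card n : ℝ)⁻¹ := by positivity
  have hsum : ∑ i, hρ.1.eigenvalues i = 1 := by
    have := hρ.1.trace_eq_sum_eigenvalues
    rw [h1, ← RCLike.ofReal_sum] at this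
    exact (RCLike.ofReal_injective (this.symm.trans RCLike.ofReal_one.symm))
  have hUU : (hρ.1.eigenvectorUnitary : Matrix n n ℂ) *
      (hρ.1.eigenvectorUnitary : Matrix n n ℂ)ᴴ = 1 :=
    Unitary.mul_star_self_of_mem hρ.1.eigenvectorUnitary.2
  refine ⟨hρ.1.eigenvectorUnitary, fun i => hρ.1.eigenvalues i + (Fintype.card n : ℝ)⁻¹, hUU,
    fun i => ?_, fun i => ?_, fun i => ?_, ?_, ?_, ?_⟩
  · linarith [hρ.eigenvalues_nonneg i]
  · linarith [hρ.eigenvalues_nonneg i]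
  · have h2 : hρ.1.eigenvalues i ≤ 1 := by
      rw [← hsum]
      exact Finset.single_le_sum (fun j _ => hρ.eigenvalues_nonneg j) (Finset.mem_univ i)
    have h3 : (Fintype.card n : ℝ)⁻¹ ≤ 1 := inv_le_one_of_one_le₀ hc
    linarith
  · rw [Finset.sum_add_distrib, hsum, Finset.sum_const, Finset.card_univ, nsmul_eq_mul,
      mul_inv_cancel₀ (by positivity)]
    norm_num
  · have hd : diagonal (fun i => ((hρ.1.eigenvalues i + (Fintype.card n : ℝ)⁻¹ : ℝ) : ℂ)) =
        diagonal (RCLike.ofReal ∘ hρ.1.eigenvalues) + (Fintype.card n : ℝ)⁻¹ • 1 := by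
      rw [← diagonal_one, ← diagonal_smul, diagonal_add]
      congr 1
      ext i
      simp
    rw [conjDiag, hd, Matrix.mul_add, Matrix.add_mul, Matrix.mul_smul, Matrix.smul_mul,
      Matrix.mul_one, hUU]
    congr 1
    conv_lhs => rw [hρ.1.spectral_theorem]
    rw [Unitary.conjStarAlgAut_apply]
    rfl
  · rw [shiftedNegEntropy, dif_pos hρ.1]

lemma shiftedNegEntropy_le {ρ : Matrix n n ℂ} (hρ : ρ.PosSemidef) (h1 : ρ.trace = 1) :
    shiftedNegEntropy ρ ≤ 2 * Real.log 2 := by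
  obtain ⟨U, f, -, -, hf0, hf2, hs, -, h⟩ := exists_shifted_eq_conjDiag hρ h1
  rw [h, ← hs, Finset.sum_mul]
  exact Finset.sum_le_sum fun i _ =>
    mul_le_mul_of_nonneg_left (Real.log_le_log (hf0 i) ((hf2 i).trans_eq hs.symm)) (hf0 i).le

lemma le_shiftedNegEntropy {ρ : Matrix n n ℂ} (hρ : ρ.PosSemidef) (h1 : ρ.trace = 1) :
    -(2 * Real.log (Fintype.card n)) ≤ shiftedNegEntropy ρ := by
  obtain ⟨U, f, -, hf, hf0, -, hs, -, h⟩ := exists_shifted_eq_conjDiag hρ h1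
  have hn : Nonempty n := by
    by_contra hn
    rw [not_nonempty_iff] at hn
    simp [Matrix.trace] at h1
  have hc : (1 : ℝ) ≤ Fintype.card n := by exact_mod_cast Fintype.card_pos
  rw [h, ← mul_neg, ← Real.log_inv, ← hs, Finset.sum_mul]
  refine Finset.sum_le_sum fun i _ => mul_le_mul_of_nonneg_left ?_ (hf0 i).le
  exact Real.log_le_log (by positivity) (hf i)

lemma homNegEntropy_le {X : Matrix n n ℂ} (hX : X.PosSemidef) :
    homNegEntropy X ≤ X.trace.re * (2 * Real.log 2) := by
  rw [homNegEntropy]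
  by_cases h : X.trace.re = 0
  · rw [h, zero_mul, zero_mul]
  · exact mul_le_mul_of_nonneg_left
      (shiftedNegEntropy_le (posSemidef_normalize hX) (trace_normalize hX h)) (re_trace_nonneg hX)

lemma le_homNegEntropy {X : Matrix n n ℂ} (hX : X.PosSemidef) :
    X.trace.re * -(2 * Real.log (Fintype.card n)) ≤ homNegEntropy X := by
  rw [homNegEntropy]
  by_cases h : X.trace.re = 0
  · rw [h, zero_mul, zero_mul]
  · exact mul_le_mul_of_nonneg_left
      (le_shiftedNegEntropy (posSemidef_normalize hX) (trace_normalize hX h)) (re_trace_nonneg hX)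

/-- Strong convexity of the negative entropy, tested against contractions. -/
lemma sum_sq_trace_le_homNegEntropy {ι : Type*} [Fintype ι] {X : Matrix n n ℂ}
    {Y : ι → Matrix n n ℂ} (hX : X.PosSemidef) (hY : ∀ s, (Y s).PosSemidef) (hsum : ∑ s, Y s = X)
    {A : ι → Matrix n n ℂ} (hA : ∀ s, (A s).IsHermitian)
    (hA1 : ∀ s, (1 - A s * A s).PosSemidef) :
    ∑ s, (Y s).trace.re * ‖(A s * (normalize (Y s) - normalize X)).trace‖ ^ 2 ≤
      8 * (∑ s, homNegEntropy (Y s) - homNegEntropy X) := by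
  have htr : ∑ s, (Y s).trace.re = X.trace.re := by
    rw [← hsum, trace_sum, Complex.re_sum]
  by_cases h : X.trace.re = 0
  · have h0 : ∀ s, (Y s).trace.re = 0 := fun s => by
      rw [h, Finset.sum_eq_zero_iff_of_nonneg fun s _ => re_trace_nonneg (hY s)] at htr
      exact htr s (Finset.mem_univ s)
    simp [h0, homNegEntropy, h]
  obtain ⟨U, g, hU, -, hg, -, hgs, hgU, hgE⟩ :=
    exists_shifted_eq_conjDiag (posSemidef_normalize hX) (trace_normalize hX h)
  set L := conjDiag U (fun i => Real.log (g i)) with hL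
  set c : ℝ := (Fintype.card n : ℝ)⁻¹ with hc
  have key : ∀ s, (Y s).trace.re * ‖(A s * (normalize (Y s) - normalize X)).trace‖ ^ 2 ≤
      8 * (homNegEntropy (Y s) - (((Y s) + ((Y s).trace.re * c) • 1) * L).trace.re) := by
    intro s
    by_cases h0 : (Y s).trace.re = 0
    · simp [homNegEntropy, eq_zero_of_re_trace (hY s) h0]
    obtain ⟨V, f, hV, -, hf, -, hfs, hfV, hfE⟩ :=
      exists_shifted_eq_conjDiag (posSemidef_normalize (hY s)) (trace_normalize (hY s) h0)
    have hk := klein_pinsker hU hV hf hg (hA s) (hA1 s)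
    have h1 : normalize (Y s) - normalize X = conjDiag V f - conjDiag U g := by
      rw [← hfV, ← hgU, add_sub_add_right_eq_sub]
    have h2 : (Y s) + ((Y s).trace.re * c) • (1 : Matrix n n ℂ) =
        (Y s).trace.re • conjDiag V f := by
      rw [← hfV, smul_add, smul_normalize (hY s), smul_smul]
    rw [h1, h2, homNegEntropy, hfE, Matrix.smul_mul, trace_smul, Complex.real_smul,
      Complex.re_ofReal_mul, ← mul_sub, mul_left_comm]
    refine mul_le_mul_of_nonneg_left ?_ (re_trace_nonneg (hY s))
    rw [hfs, hgs] at hk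
    linarith
  refine (Finset.sum_le_sum fun s _ => key s).trans_eq ?_
  rw [← Finset.mul_sum, Finset.sum_sub_distrib]
  congr 2
  rw [← Complex.re_sum, ← trace_sum, ← Finset.sum_mul, Finset.sum_add_distrib, hsum,
    ← Finset.sum_smul, ← Finset.sum_mul, htr]
  have h2 : X + (X.trace.re * c) • (1 : Matrix n n ℂ) = X.trace.re • conjDiag U g := by
    rw [← hgU, smul_add, smul_normalize hX, smul_smul]
  rw [h2, hL, homNegEntropy, hgE, Matrix.smul_mul, trace_smul, Complex.real_smul,
      Complex.re_ofReal_mul, trace_conjDiag_mul_conjDiag hU, Complex.ofReal_re]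

end Entropy

section Measurement

variable {d m : ℕ}

/-- The state of the first `m` sites after the effect `E` has been observed on the last site,
weighted by its probability. -/
def measureLast (E : Matrix (Fin d) (Fin d) ℂ) :
    Matrix (Fin (m + 1) → Fin d) (Fin (m + 1) → Fin d) ℂ →ₗ[ℂ]
      Matrix (Fin m → Fin d) (Fin m → Fin d) ℂ where
  toFun Γ := of fun a b => ∑ u, ∑ v,
    E v u * Γ (Fin.snoc a u : Fin (m + 1) → Fin d) (Fin.snoc b v : Fin (m + 1) → Fin d)
  map_add' Γ Γ' := by
    ext a b
    simp [mul_add, Finset.sum_add_distrib]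
  map_smul' c Γ := by
    ext a b
    simp [Finset.mul_sum, mul_left_comm]

lemma measureLast_apply (E : Matrix (Fin d) (Fin d) ℂ)
    (Γ : Matrix (Fin (m + 1) → Fin d) (Fin (m + 1) → Fin d) ℂ) (a b : Fin m → Fin d) :
    measureLast E Γ a b = ∑ u, ∑ v,
      E v u * Γ (Fin.snoc a u : Fin (m + 1) → Fin d) (Fin.snoc b v : Fin (m + 1) → Fin d) := rfl

lemma measureLast_one_apply (Γ : Matrix (Fin (m + 1) → Fin d) (Fin (m + 1) → Fin d) ℂ)
    (a b : Fin m → Fin d) :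
    measureLast 1 Γ a b = ∑ u,
      Γ (Fin.snoc a u : Fin (m + 1) → Fin d) (Fin.snoc b u : Fin (m + 1) → Fin d) := by
  simp [measureLast_apply, one_apply]

lemma trace_measureLast_one (Γ : Matrix (Fin (m + 1) → Fin d) (Fin (m + 1) → Fin d) ℂ) :
    (measureLast 1 Γ).trace = Γ.trace := by
  simp only [Matrix.trace, diag_apply, measureLast_one_apply]
  rw [← (Fin.snocEquiv fun _ : Fin (m + 1) => Fin d).sum_comp, Fintype.sum_prod_type_right]
  rfl

lemma sum_measureLast {ι : Type*} [Fintype ι] (E : ι → Matrix (Fin d) (Fin d) ℂ)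
    (Γ : Matrix (Fin (m + 1) → Fin d) (Fin (m + 1) → Fin d) ℂ) :
    ∑ s, measureLast (E s) Γ = measureLast (∑ s, E s) Γ := by
  ext a b
  simp only [Matrix.sum_apply, measureLast_apply, Finset.sum_mul]
  rw [Finset.sum_comm]
  exact Finset.sum_congr rfl fun u _ => Finset.sum_comm

lemma posSemidef_measureLast {E : Matrix (Fin d) (Fin d) ℂ} (hE : E.PosSemidef)
    {Γ : Matrix (Fin (m + 1) → Fin d) (Fin (m + 1) → Fin d) ℂ} (hΓ : Γ.PosSemidef) :
    (measureLast E Γ).PosSemidef := by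
  have h1 := (hE.transpose.submatrix (fun p : (Fin m → Fin d) × Fin d => p.2)).hadamard
    (hΓ.submatrix (fun p : (Fin m → Fin d) × Fin d => (Fin.snoc p.1 p.2 : Fin (m + 1) → Fin d)))
  have h2 := h1.conjTranspose_mul_mul_same
    (of fun (p : (Fin m → Fin d) × Fin d) a => if p.1 = a then (1 : ℂ) else 0)
  refine (congrArg PosSemidef ?_).mpr h2
  ext a b
  simp only [measureLast_apply, Matrix.mul_apply, Fintype.sum_prod_type, conjTranspose_apply,
    of_apply, hadamard_apply, submatrix_apply, transpose_apply, apply_ite star, star_one, star_zero,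
    ite_mul, one_mul, zero_mul, mul_ite, mul_one, mul_zero]
  simp only [Finset.sum_ite_irrel, Finset.sum_const_zero, Finset.sum_ite_eq', Finset.mem_univ,
    if_true]
  exact Finset.sum_comm

/-- Invariance of a many-body matrix under permutations of the sites. -/
def PermInvariant (Γ : Matrix (Fin m → Fin d) (Fin m → Fin d) ℂ) : Prop :=
  ∀ σ : Equiv.Perm (Fin m), ∀ x y : Fin m → Fin d, Γ (x ∘ σ) (y ∘ σ) = Γ x y

lemma PermInvariant.measureLast {E : Matrix (Fin d) (Fin d) ℂ}
    {Γ : Matrix (Fin (m + 1) → Fin d) (Fin (m + 1) → Fin d) ℂ} (hΓ : PermInvariant Γ) :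
    PermInvariant (measureLast E Γ) := by
  intro σ a b
  let τ : Equiv.Perm (Fin (m + 1)) := finSuccEquivLast.permCongr.symm (Equiv.optionCongr σ)
  have h : ∀ (c : Fin m → Fin d) (u : Fin d),
      (Fin.snoc (c ∘ σ) u : Fin (m + 1) → Fin d) = (Fin.snoc c u : Fin (m + 1) → Fin d) ∘ τ := by
    intro c u
    ext i
    refine Fin.lastCases ?_ (fun j => ?_) i
    · simp [τ]
    · simp [τ]
  simp only [measureLast_apply, h, hΓ τ]

lemma measureLast_comm (E F : Matrix (Fin d) (Fin d) ℂ)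
    {Γ : Matrix (Fin (m + 1 + 1) → Fin d) (Fin (m + 1 + 1) → Fin d) ℂ} (hΓ : PermInvariant Γ) :
    measureLast E (measureLast F Γ) = measureLast F (measureLast E Γ) := by
  let τ : Equiv.Perm (Fin (m + 1 + 1)) := Equiv.swap (Fin.last _) (Fin.castSucc (Fin.last _))
  have h : ∀ (c : Fin m → Fin d) (u u' : Fin d),
      (Fin.snoc (Fin.snoc c u : Fin (m + 1) → Fin d) u' : Fin (m + 1 + 1) → Fin d) ∘ τ =
      (Fin.snoc (Fin.snoc c u' : Fin (m + 1) → Fin d) u : Fin (m + 1 + 1) → Fin d) := by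
    intro c u u'
    ext i
    refine Fin.lastCases ?_ (fun j => Fin.lastCases ?_ (fun k => ?_) j) i
    · simp [τ]
    · simp [τ]
    · have h1 : (Fin.castSucc (Fin.castSucc k)) ≠ Fin.last (m + 1) := Fin.castSucc_ne_last _
      have h2 : (Fin.castSucc (Fin.castSucc k)) ≠ Fin.castSucc (Fin.last m) := by
        simp
      simp [τ, Equiv.swap_apply_of_ne_of_ne h1 h2]
  ext a b
  simp only [measureLast_apply, Finset.mul_sum]
  have e : ∀ u v u' v' : Fin d,
      Γ (Fin.snoc (Fin.snoc a u : Fin (m + 1) → Fin d) u')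
        (Fin.snoc (Fin.snoc b v : Fin (m + 1) → Fin d) v') =
      Γ (Fin.snoc (Fin.snoc a u' : Fin (m + 1) → Fin d) u)
        (Fin.snoc (Fin.snoc b v' : Fin (m + 1) → Fin d) v) := fun u v u' v' => by
    rw [← h a u' u, ← h b v' v, hΓ]
  calc _ = ∑ u, ∑ u', ∑ v, ∑ v', E v u * (F v' u' *
        Γ (Fin.snoc (Fin.snoc a u : Fin (m + 1) → Fin d) u')
        (Fin.snoc (Fin.snoc b v : Fin (m + 1) → Fin d) v')) :=
        Finset.sum_congr rfl fun u _ => Finset.sum_comm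
    _ = ∑ u', ∑ u, ∑ v', ∑ v, E v u * (F v' u' *
        Γ (Fin.snoc (Fin.snoc a u : Fin (m + 1) → Fin d) u')
        (Fin.snoc (Fin.snoc b v : Fin (m + 1) → Fin d) v')) := by
        rw [Finset.sum_comm]
        exact Finset.sum_congr rfl fun _ _ => Finset.sum_congr rfl fun _ _ => Finset.sum_comm
    _ = ∑ u', ∑ u, ∑ v', ∑ v, F v' u' * (E v u *
        Γ (Fin.snoc (Fin.snoc a u' : Fin (m + 1) → Fin d) u)
        (Fin.snoc (Fin.snoc b v' : Fin (m + 1) → Fin d) v)) := by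
        refine Finset.sum_congr rfl fun _ _ => Finset.sum_congr rfl fun _ _ =>
          Finset.sum_congr rfl fun _ _ => Finset.sum_congr rfl fun _ _ => ?_
        rw [e, mul_left_comm]
    _ = _ := Finset.sum_congr rfl fun u _ => Finset.sum_comm

/-- The marginal on the first three sites. -/
def marginal : (m : ℕ) → Matrix (Fin (m + 3) → Fin d) (Fin (m + 3) → Fin d) ℂ →ₗ[ℂ]
    Matrix (Fin 3 → Fin d) (Fin 3 → Fin d) ℂ
  | 0 => LinearMap.id
  | m + 1 => marginal m ∘ₗ measureLast 1

lemma marginal_succ (Γ : Matrix (Fin (m + 1 + 3) → Fin d) (Fin (m + 1 + 3) → Fin d) ℂ) :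
    marginal (m + 1) Γ = marginal m (measureLast 1 Γ) := rfl

lemma posSemidef_marginal {Γ : Matrix (Fin (m + 3) → Fin d) (Fin (m + 3) → Fin d) ℂ}
    (hΓ : Γ.PosSemidef) : (marginal m Γ).PosSemidef := by
  induction m with
  | zero => exact hΓ
  | succ m ih => exact ih (posSemidef_measureLast PosSemidef.one hΓ)

lemma PermInvariant.marginal {Γ : Matrix (Fin (m + 3) → Fin d) (Fin (m + 3) → Fin d) ℂ}
    (hΓ : PermInvariant Γ) : PermInvariant (marginal m Γ) := by
  induction m with
  | zero => exact hΓ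
  | succ m ih => exact ih hΓ.measureLast

lemma measureLast_marginal_measureLast (E : Matrix (Fin d) (Fin d) ℂ)
    {Γ : Matrix (Fin (m + 1 + 3) → Fin d) (Fin (m + 1 + 3) → Fin d) ℂ} (hΓ : PermInvariant Γ) :
    measureLast 1 (marginal m (measureLast E Γ)) = measureLast E (marginal (m + 1) Γ) := by
  induction m with
  | zero => exact measureLast_comm (m := 2) 1 E hΓ
  | succ m ih =>
    have h := measureLast_comm (m := m + 3) 1 E hΓ
    rw [marginal_succ, marginal_succ]
    exact (congrArg (fun G => measureLast 1 (QuantumDeFinetti.marginal m G)) h).trans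
      (ih hΓ.measureLast)

lemma marginal_apply (Γ : Matrix (Fin (m + 3) → Fin d) (Fin (m + 3) → Fin d) ℂ)
    (a b : Fin 3 → Fin d) (h : m + 3 = 3 + m) :
    marginal m Γ a b = ∑ c : Fin m → Fin d,
      Γ (fun i => Fin.append a c (Fin.cast h i)) (fun i => Fin.append b c (Fin.cast h i)) := by
  induction m with
  | zero =>
    have e : ∀ (a : Fin 3 → Fin d) (c : Fin 0 → Fin d),
        (fun i => Fin.append a c (Fin.cast h i)) = a := fun a c => by
      ext i
      fin_cases i <;> rfl
    simp only [marginal, LinearMap.id_apply, Fintype.sum_unique, e]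
  | succ m ih =>
    have e : ∀ (a : Fin 3 → Fin d) (c : Fin m → Fin d) (u : Fin d),
        (fun i => Fin.append a (Fin.snoc c u : Fin (m + 1) → Fin d) (Fin.cast h i)) =
        (Fin.snoc (fun i : Fin (m + 3) => Fin.append a c (Fin.cast (by omega) i)) u :
          Fin (m + 3 + 1) → Fin d) := by
      intro a c u
      rw [Fin.append_snoc]
      funext i
      refine Fin.lastCases ?_ (fun j => ?_) i
      · rw [show Fin.cast h (Fin.last (m + 3)) = Fin.last (3 + m) from
          Fin.ext (Nat.add_comm m 3), Fin.snoc_last]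
        exact Fin.snoc_last (n := 3 + m) (α := fun _ => Fin d) _ _
      · rw [show Fin.cast h (Fin.castSucc j) =
          Fin.castSucc (n := 3 + m) (Fin.cast (Nat.add_comm m 3) j) from rfl,
          Fin.snoc_castSucc, Fin.snoc_castSucc]
    rw [marginal_succ, ih _ (by omega)]
    simp only [measureLast_one_apply]
    rw [← (Fin.snocEquiv fun _ : Fin (m + 1) => Fin d).sum_comp, Fintype.sum_prod_type_right]
    refine Finset.sum_congr rfl fun c _ => Finset.sum_congr rfl fun u _ => ?_
    rw [← e, ← e]
    rfl

lemma red3_eq_marginal (hK : 3 ≤ m + 3)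
    (Γ : Matrix (Fin (m + 3) → Fin d) (Fin (m + 3) → Fin d) ℂ) :
    red3 hK Γ = marginal m Γ := by
  ext a b
  rw [marginal_apply Γ a b (by omega)]
  rfl

end Measurement

section Correlations

variable {d : ℕ}

/-- The Kronecker product `A ⊗ B`, indexed by pairs of indices. -/
def pair (A B : Matrix (Fin d) (Fin d) ℂ) : Matrix (Fin 2 → Fin d) (Fin 2 → Fin d) ℂ :=
  (kroneckerMap (· * ·) A B).submatrix (finTwoArrowEquiv (Fin d)) (finTwoArrowEquiv (Fin d))

lemma pair_apply (A B : Matrix (Fin d) (Fin d) ℂ) (x y : Fin 2 → Fin d) :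
    pair A B x y = A (x 0) (y 0) * B (x 1) (y 1) := rfl

lemma pair_one_one : pair (1 : Matrix (Fin d) (Fin d) ℂ) 1 = 1 := by
  rw [pair, one_kronecker_one, submatrix_one_equiv]

lemma pair_mul_pair (A B A' B' : Matrix (Fin d) (Fin d) ℂ) :
    pair A B * pair A' B' = pair (A * A') (B * B') := by
  rw [pair, pair, pair, submatrix_mul_equiv, mul_kronecker_mul]

lemma posSemidef_pair {A B : Matrix (Fin d) (Fin d) ℂ} (hA : A.PosSemidef) (hB : B.PosSemidef) :
    (pair A B).PosSemidef :=
  (hA.kronecker hB).submatrix _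

lemma isHermitian_pair {A B : Matrix (Fin d) (Fin d) ℂ} (hA : A.IsHermitian)
    (hB : B.IsHermitian) : (pair A B).IsHermitian := by
  ext x y
  simp only [conjTranspose_apply, pair_apply, star_mul', hA.apply, hB.apply]

/-- The Hermitian matrices with `-1 ≤ A ≤ 1`. -/
def IsObservable (A : Matrix (Fin d) (Fin d) ℂ) : Prop :=
  A.IsHermitian ∧ (1 - A).PosSemidef ∧ (1 + A).PosSemidef

lemma isObservable_one : IsObservable (1 : Matrix (Fin d) (Fin d) ℂ) :=
  ⟨isHermitian_one, by rw [sub_self]; exact PosSemidef.zero, PosSemidef.one.add PosSemidef.one⟩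

lemma IsObservable.posSemidef_one_sub_mul_self {A : Matrix (Fin d) (Fin d) ℂ}
    (hA : IsObservable A) : (1 - A * A).PosSemidef := by
  obtain ⟨h0, h1, h2⟩ := hA
  have h3 := h1.conjTranspose_mul_mul_same (1 + A)
  have h4 := h2.conjTranspose_mul_mul_same (1 - A)
  have h5 : 1 - A * A = (1 / 2 : ℝ) •
      ((1 + A)ᴴ * (1 - A) * (1 + A) + (1 - A)ᴴ * (1 + A) * (1 - A)) := by
    rw [h1.1.eq, h2.1.eq]
    have : (1 + A) * (1 - A) * (1 + A) + (1 - A) * (1 + A) * (1 - A) = (2 : ℝ) • (1 - A * A) := by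
      rw [two_smul]
      noncomm_ring
    rw [this, smul_smul]
    norm_num
  rw [h5]
  exact (h3.add h4).smul (by norm_num)

lemma posSemidef_one_sub_pair_mul_self {A B : Matrix (Fin d) (Fin d) ℂ}
    (hA : IsObservable A) (hB : IsObservable B) :
    (1 - pair A B * pair A B).PosSemidef := by
  have h : 1 - pair A B * pair A B = pair (1 - A * A) 1 + pair (A * A) (1 - B * B) := by
    rw [pair_mul_pair, ← pair_one_one]
    ext x y
    simp only [Matrix.sub_apply, Matrix.add_apply, pair_apply]
    ring
  rw [h]
  refine (posSemidef_pair hA.posSemidef_one_sub_mul_self PosSemidef.one).add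
    (posSemidef_pair ?_ hB.posSemidef_one_sub_mul_self)
  have := posSemidef_conjTranspose_mul_self A
  rwa [hA.1.eq] at this

lemma trace_trip_mul (A B E : Matrix (Fin d) (Fin d) ℂ)
    (ω : Matrix (Fin 3 → Fin d) (Fin 3 → Fin d) ℂ) :
    (trip A B E * ω).trace = (pair A B * measureLast E ω).trace := by
  simp only [Matrix.trace, Matrix.diag_apply, Matrix.mul_apply, measureLast_apply, Finset.mul_sum]
  rw [← (Fin.snocEquiv fun _ : Fin 3 => Fin d).sum_comp, Fintype.sum_prod_type_right]
  refine Finset.sum_congr rfl fun x _ => ?_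
  calc _ = ∑ v, ∑ y : Fin 2 → Fin d, ∑ u, pair A B x y * (E v u *
        ω (Fin.snoc y u : Fin 3 → Fin d) (Fin.snoc x v : Fin 3 → Fin d)) := by
        refine Finset.sum_congr rfl fun v _ => ?_
        rw [← (Fin.snocEquiv fun _ : Fin 3 => Fin d).sum_comp, Fintype.sum_prod_type_right]
        refine Finset.sum_congr rfl fun y _ => Finset.sum_congr rfl fun u _ => ?_
        rw [← mul_assoc]
        rfl
    _ = _ := by
        rw [Finset.sum_comm]
        exact Finset.sum_congr rfl fun y _ => Finset.sum_comm

lemma trace_trip_mul_perm (σ : Equiv.Perm (Fin 3)) (M : Fin 3 → Matrix (Fin d) (Fin d) ℂ)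
    {ω : Matrix (Fin 3 → Fin d) (Fin 3 → Fin d) ℂ} (hω : PermInvariant ω) :
    (trip (M (σ 0)) (M (σ 1)) (M (σ 2)) * ω).trace = (trip (M 0) (M 1) (M 2) * ω).trace := by
  have h : ∀ x y : Fin 3 → Fin d, trip (M (σ 0)) (M (σ 1)) (M (σ 2)) (x ∘ σ) (y ∘ σ) =
      trip (M 0) (M 1) (M 2) x y := by
    intro x y
    have := Equiv.prod_comp σ (fun i => M i (x i) (y i))
    simpa [Fin.prod_univ_three, trip] using this
  simp only [Matrix.trace, Matrix.diag_apply, Matrix.mul_apply]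
  rw [← (Equiv.arrowCongr σ.symm (Equiv.refl (Fin d))).sum_comp]
  refine Finset.sum_congr rfl fun x _ => ?_
  rw [← (Equiv.arrowCongr σ.symm (Equiv.refl (Fin d))).sum_comp]
  refine Finset.sum_congr rfl fun y _ => ?_
  exact congrArg₂ (· * ·) (h x y) (hω σ y x)

lemma trace_trip_mul_swap_right (A B C : Matrix (Fin d) (Fin d) ℂ)
    {ω : Matrix (Fin 3 → Fin d) (Fin 3 → Fin d) ℂ} (hω : PermInvariant ω) :
    (trip A B C * ω).trace = (trip A C B * ω).trace :=
  trace_trip_mul_perm (Equiv.swap 1 2) ![A, C, B] hω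

lemma trace_trip_mul_swap_outer (A B C : Matrix (Fin d) (Fin d) ℂ)
    {ω : Matrix (Fin 3 → Fin d) (Fin 3 → Fin d) ℂ} (hω : PermInvariant ω) :
    (trip A B C * ω).trace = (trip C B A * ω).trace :=
  trace_trip_mul_perm (Equiv.swap 0 2) ![C, B, A] hω

lemma trace_trip_mul_smul_one_add (A B C : Matrix (Fin d) (Fin d) ℂ) (r : ℝ)
    (ω : Matrix (Fin 3 → Fin d) (Fin 3 → Fin d) ℂ) :
    (trip A B (r • (1 + C)) * ω).trace =
      r * ((trip A B 1 * ω).trace + (trip A B C * ω).trace) := by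
  have : trip A B (r • (1 + C)) = (r : ℂ) • (trip A B 1 + trip A B C) := by
    ext x y
    simp [trip]
    ring
  rw [this, Matrix.smul_mul, Matrix.add_mul, trace_smul, trace_add, smul_eq_mul]

lemma trace_trip_mul_smul_one_sub (A B C : Matrix (Fin d) (Fin d) ℂ) (r : ℝ)
    (ω : Matrix (Fin 3 → Fin d) (Fin 3 → Fin d) ℂ) :
    (trip A B (r • (1 - C)) * ω).trace =
      r * ((trip A B 1 * ω).trace - (trip A B C * ω).trace) := by
  have : trip A B (r • (1 - C)) = (r : ℂ) • (trip A B 1 - trip A B C) := by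
    ext x y
    simp [trip]
    ring
  rw [this, Matrix.smul_mul, Matrix.sub_mul, trace_smul, trace_sub, smul_eq_mul]

lemma trace_measureLast (E : Matrix (Fin d) (Fin d) ℂ)
    (ω : Matrix (Fin 3 → Fin d) (Fin 3 → Fin d) ℂ) :
    (measureLast E ω).trace = (trip 1 1 E * ω).trace := by
  rw [trace_trip_mul, pair_one_one, Matrix.one_mul]

lemma trip_one_one_one : trip (1 : Matrix (Fin d) (Fin d) ℂ) 1 1 = 1 := by
  ext x y
  simp only [trip, of_apply, one_apply, funext_iff, Fin.forall_fin_succ, Fin.succ_zero_eq_one]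
  simp only [mul_ite, mul_one, mul_zero, ← ite_and]
  refine if_congr ?_ rfl rfl
  simp only [Fin.succ_one_eq_two, IsEmpty.forall_iff, and_true]
  tauto

/-- The marginal of a two-site matrix on the first site. -/
def firstMarginal (X : Matrix (Fin 2 → Fin d) (Fin 2 → Fin d) ℂ) : Matrix (Fin d) (Fin d) ℂ :=
  (measureLast 1 X).submatrix (fun a _ => a) (fun a _ => a)

lemma trace_mul_firstMarginal (A : Matrix (Fin d) (Fin d) ℂ)
    (X : Matrix (Fin 2 → Fin d) (Fin 2 → Fin d) ℂ) :
    (A * firstMarginal X).trace = (pair A 1 * X).trace := by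
  simp only [Matrix.trace, Matrix.diag_apply, Matrix.mul_apply, firstMarginal, submatrix_apply,
    measureLast_one_apply, Finset.mul_sum]
  rw [← (finTwoArrowEquiv (Fin d)).symm.sum_comp, Fintype.sum_prod_type]
  refine Finset.sum_congr rfl fun a _ => ?_
  rw [Finset.sum_comm]
  refine Finset.sum_congr rfl fun u _ => ?_
  rw [← (finTwoArrowEquiv (Fin d)).symm.sum_comp, Fintype.sum_prod_type]
  refine Finset.sum_congr rfl fun b _ => ?_
  have e : ∀ a u : Fin d,
      (Fin.snoc (fun _ => a : Fin 1 → Fin d) u : Fin 2 → Fin d) = ![a, u] := fun a u => by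
    ext i
    fin_cases i <;> rfl
  simp [pair_apply, one_apply, e]

/-- The one-body marginal of a positive three-body matrix, rescaled to a state. -/
def oneBodyState (ω : Matrix (Fin 3 → Fin d) (Fin 3 → Fin d) ℂ) : Matrix (Fin d) (Fin d) ℂ :=
  if ω.trace.re = 0 then (d : ℝ)⁻¹ • 1 else firstMarginal (normalize (measureLast 1 ω))

lemma posSemidef_oneBodyState {ω : Matrix (Fin 3 → Fin d) (Fin 3 → Fin d) ℂ}
    (hω : ω.PosSemidef) : (oneBodyState ω).PosSemidef := by
  rw [oneBodyState]
  split_ifs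
  · exact PosSemidef.one.smul (by positivity)
  · exact (posSemidef_measureLast PosSemidef.one
      (posSemidef_normalize (posSemidef_measureLast PosSemidef.one hω))).submatrix _

lemma trace_oneBodyState (hd : d ≠ 0) {ω : Matrix (Fin 3 → Fin d) (Fin 3 → Fin d) ℂ}
    (hω : ω.PosSemidef) : (oneBodyState ω).trace = 1 := by
  rw [oneBodyState]
  split_ifs with h
  · simp [hd]
  · have h1 := trace_mul_firstMarginal 1 (normalize (measureLast 1 ω))
    rw [pair_one_one, Matrix.one_mul, Matrix.one_mul] at h1
    rw [h1, trace_normalize (posSemidef_measureLast PosSemidef.one hω)]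
    rwa [trace_measureLast_one]

/-- The four effects of the measurement that performs, with probability one half each, the
two-outcome measurements of the observables `B` and `C`. -/
def effect (B C : Matrix (Fin d) (Fin d) ℂ) : Bool × Bool → Matrix (Fin d) (Fin d) ℂ
  | (true, true) => (1 / 4 : ℝ) • (1 + C)
  | (true, false) => (1 / 4 : ℝ) • (1 - C)
  | (false, true) => (1 / 4 : ℝ) • (1 + B)
  | (false, false) => (1 / 4 : ℝ) • (1 - B)

lemma posSemidef_effect {B C : Matrix (Fin d) (Fin d) ℂ} (hB : IsObservable B)
    (hC : IsObservable C) (o : Bool × Bool) : (effect B C o).PosSemidef := by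
  rcases o with ⟨_ | _, _ | _⟩
  · exact hB.2.1.smul (by norm_num)
  · exact hB.2.2.smul (by norm_num)
  · exact hC.2.1.smul (by norm_num)
  · exact hC.2.2.smul (by norm_num)

lemma sum_effect (B C : Matrix (Fin d) (Fin d) ℂ) : ∑ o, effect B C o = 1 := by
  simp only [Fintype.sum_prod_type, Fintype.sum_bool, effect, smul_add, smul_sub]
  module

/-- The two-body observable tested against each outcome of `effect`. -/
def probe (A B : Matrix (Fin d) (Fin d) ℂ) : Bool × Bool → Matrix (Fin 2 → Fin d) (Fin 2 → Fin d) ℂ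
  | (true, _) => pair A B
  | (false, _) => pair A 1

/-- The distance of a three-body state from the third power of its one-body marginal, tested on a
product observable, is controlled by the entropy decrease under the measurement `effect`. -/
lemma norm_trace_trip_sub_le {ω : Matrix (Fin 3 → Fin d) (Fin 3 → Fin d) ℂ} (hω : ω.PosSemidef)
    (hs : PermInvariant ω) {A B C : Matrix (Fin d) (Fin d) ℂ} (hA : IsObservable A)
    (hB : IsObservable B) (hC : IsObservable C) {ε : ℝ} (hε : 0 < ε) :
    ‖(trip A B C * ω).trace - ω.trace.re * ((A * oneBodyState ω).trace *
        (B * oneBodyState ω).trace * (C * oneBodyState ω).trace)‖ ≤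
      ε / 2 * ω.trace.re + 16 / ε * (∑ o, homNegEntropy (measureLast (effect B C o) ω) -
        homNegEntropy (measureLast 1 ω)) := by
  by_cases h0 : ω.trace.re = 0
  · simp [eq_zero_of_re_trace hω h0, homNegEntropy]
  set X := measureLast 1 ω with hX
  have hXp : X.PosSemidef := posSemidef_measureLast PosSemidef.one hω
  have hXt : X.trace.re = ω.trace.re := by rw [hX, trace_measureLast_one]
  set τ : ℝ := ω.trace.re with hτ
  have hγ : oneBodyState ω = firstMarginal (normalize X) := by rw [oneBodyState, if_neg h0]
  set γ := oneBodyState ω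
  set Y := fun o => measureLast (effect B C o) ω with hY
  have hYp : ∀ o, (Y o).PosSemidef := fun o =>
    posSemidef_measureLast (posSemidef_effect hB hC o) hω
  have hYs : ∑ o, Y o = X := by rw [hY, sum_measureLast, sum_effect]
  have hent := sum_sq_trace_le_homNegEntropy hXp hYp hYs (A := probe A B)
    (by
      rintro ⟨_ | _, o⟩
      · exact isHermitian_pair hA.1 isHermitian_one
      · exact isHermitian_pair hA.1 hB.1)
    (by
      rintro ⟨_ | _, o⟩
      · exact posSemidef_one_sub_pair_mul_self hA isObservable_one
      · exact posSemidef_one_sub_pair_mul_self hA hB)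
  set z : Bool × Bool → ℂ := fun o => (probe A B o * (normalize (Y o) - normalize X)).trace with hz
  set t : Bool × Bool → ℝ := fun o => (Y o).trace.re with ht
  have ht0 : ∀ o, 0 ≤ t o := fun o => re_trace_nonneg (hYp o)
  have htz : ∀ o, (t o : ℂ) * z o =
      (probe A B o * Y o).trace - t o * (probe A B o * normalize X).trace := fun o => by
    simp only [hz]
    rw [Matrix.mul_sub, trace_sub, mul_sub]
    congr 1
    conv_rhs => rw [← smul_normalize (hYp o), Matrix.mul_smul, trace_smul, Complex.real_smul]
  have hXn : ∀ D E : Matrix (Fin d) (Fin d) ℂ,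
      (trip D E 1 * ω).trace = τ * (pair D E * normalize X).trace := fun D E => by
    rw [trace_trip_mul, ← hX]
    conv_lhs => rw [← smul_normalize hXp, Matrix.mul_smul, trace_smul, Complex.real_smul, hXt]
  have hXγ : ∀ D : Matrix (Fin d) (Fin d) ℂ,
      (pair D 1 * normalize X).trace = (D * γ).trace := fun D => by
    rw [hγ, trace_mul_firstMarginal]
  have hL1 : (trip 1 1 1 * ω).trace = (τ : ℂ) := by
    rw [trip_one_one_one, Matrix.one_mul, ofReal_re_trace hω]
  have hL2 : ∀ D : Matrix (Fin d) (Fin d) ℂ, (trip 1 1 D * ω).trace = τ * (D * γ).trace :=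
    fun D => by rw [trace_trip_mul_swap_outer _ _ _ hs, hXn, hXγ]
  have htE : ∀ o, (t o : ℂ) = (trip 1 1 (effect B C o) * ω).trace := fun o => by
    rw [← trace_measureLast]
    exact ofReal_re_trace (hYp o)
  have hYE : ∀ D E o, (pair D E * Y o).trace = (trip D E (effect B C o) * ω).trace :=
    fun D E o => (trace_trip_mul D E _ ω).symm
  set α := (A * γ).trace
  set β := (B * γ).trace
  set κ := (C * γ).trace
  set p := (pair A B * normalize X).trace
  set N := (trip A B C * ω).trace
  have t1 : (t (true, true) : ℂ) = τ / 4 * (1 + κ) := by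
    rw [htE, effect, trace_trip_mul_smul_one_add, hL1, hL2]; push_cast; ring
  have t2 : (t (true, false) : ℂ) = τ / 4 * (1 - κ) := by
    rw [htE, effect, trace_trip_mul_smul_one_sub, hL1, hL2]; push_cast; ring
  have t3 : (t (false, true) : ℂ) = τ / 4 * (1 + β) := by
    rw [htE, effect, trace_trip_mul_smul_one_add, hL1, hL2]; push_cast; ring
  have t4 : (t (false, false) : ℂ) = τ / 4 * (1 - β) := by
    rw [htE, effect, trace_trip_mul_smul_one_sub, hL1, hL2]; push_cast; ring
  have z1 : (t (true, true) : ℂ) * z (true, true) = 1 / 4 * (τ * p + N) - τ / 4 * (1 + κ) * p := by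
    rw [htz, t1, probe, hYE, effect, trace_trip_mul_smul_one_add, hXn]; push_cast; ring
  have z2 : (t (true, false) : ℂ) * z (true, false) =
      1 / 4 * (τ * p - N) - τ / 4 * (1 - κ) * p := by
    rw [htz, t2, probe, hYE, effect, trace_trip_mul_smul_one_sub, hXn]; push_cast; ring
  have z3 : (t (false, true) : ℂ) * z (false, true) =
      1 / 4 * (τ * α + τ * p) - τ / 4 * (1 + β) * α := by
    rw [htz, t3, probe, hYE, effect, trace_trip_mul_smul_one_add,
      trace_trip_mul_swap_right A 1 B hs, hXn, hXn, hXγ]; push_cast; ring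
  have z4 : (t (false, false) : ℂ) * z (false, false) =
      1 / 4 * (τ * α - τ * p) - τ / 4 * (1 - β) * α := by
    rw [htz, t4, probe, hYE, effect, trace_trip_mul_smul_one_sub,
      trace_trip_mul_swap_right A 1 B hs, hXn, hXn, hXγ]; push_cast; ring
  have hκ : ‖κ‖ ≤ 1 := by
    have e1 : (τ : ℂ) * κ = ((2 * (t (true, true) - t (true, false)) : ℝ) : ℂ) := by
      push_cast
      rw [t1, t2]
      ring
    have e2 : τ = 2 * (t (true, true) + t (true, false)) := by
      have : (τ : ℂ) = ((2 * (t (true, true) + t (true, false)) : ℝ) : ℂ) := by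
        push_cast
        rw [t1, t2]
        ring
      exact_mod_cast this
    have hτ0 : 0 < τ := lt_of_le_of_ne (re_trace_nonneg hω) (Ne.symm h0)
    have e3 := congrArg norm e1
    rw [norm_mul, Complex.norm_real, Complex.norm_real, Real.norm_of_nonneg hτ0.le] at e3
    have e4 : ‖2 * (t (true, true) - t (true, false))‖ ≤ τ := by
      rw [Real.norm_eq_abs, abs_le]
      constructor <;> linarith [ht0 (true, true), ht0 (true, false)]
    rw [← e3] at e4
    exact le_of_mul_le_mul_left (by linarith) hτ0
  have hdec : N - τ * (α * β * κ) =
      2 * (t (true, true) * z (true, true)) - 2 * (t (true, false) * z (true, false)) +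
      κ * (2 * (t (false, true) * z (false, true)) - 2 * (t (false, false) * z (false, false))) := by
    rw [z1, z2, z3, z4]
    ring
  have hn : ∀ o, ‖2 * ((t o : ℂ) * z o)‖ = 2 * (t o * ‖z o‖) := fun o => by
    rw [norm_mul, norm_mul, Complex.norm_real, Real.norm_of_nonneg (ht0 o), Complex.norm_two]
  have hsumt : ∑ o, t o = τ := by
    rw [ht, ← Complex.re_sum, ← trace_sum, hYs, hXt]
  calc ‖N - τ * (α * β * κ)‖ ≤ ∑ o, 2 * (t o * ‖z o‖) := by
        rw [hdec]
        simp only [Fintype.sum_prod_type, Fintype.sum_bool, ← hn]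
        refine (norm_add_le _ _).trans (add_le_add (norm_sub_le _ _) ?_)
        rw [norm_mul]
        exact (mul_le_of_le_one_left (norm_nonneg _) hκ).trans (norm_sub_le _ _)
    _ ≤ ∑ o, (ε / 2 * t o + 2 / ε * (t o * ‖z o‖ ^ 2)) := by
        refine Finset.sum_le_sum fun o _ => ?_
        have h : 2 * ‖z o‖ ≤ ε / 2 + 2 / ε * ‖z o‖ ^ 2 := by
          have : ε / 2 + 2 / ε * ‖z o‖ ^ 2 - 2 * ‖z o‖ = (ε - 2 * ‖z o‖) ^ 2 / (2 * ε) := by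
            field_simp
            ring
          have h2 : 0 ≤ (ε - 2 * ‖z o‖) ^ 2 / (2 * ε) := by positivity
          linarith
        nlinarith [mul_le_mul_of_nonneg_left h (ht0 o)]
    _ = ε / 2 * τ + 2 / ε * ∑ o, t o * ‖z o‖ ^ 2 := by
        rw [Finset.sum_add_distrib, ← Finset.mul_sum, ← Finset.mul_sum, hsumt]
    _ ≤ ε / 2 * τ + 2 / ε * (8 * (∑ o, homNegEntropy (Y o) - homNegEntropy X)) := by gcongr
    _ = _ := by ring

end Correlations

section DeFinetti

variable {d m : ℕ}

lemma trace_marginal (Γ : Matrix (Fin (m + 3) → Fin d) (Fin (m + 3) → Fin d) ℂ) :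
    (marginal m Γ).trace = Γ.trace := by
  induction m with
  | zero => rfl
  | succ m ih => rw [marginal_succ, ih, trace_measureLast_one]

/-- If observables `A`, `B`, `C` distinguish a family of three-body states from the mixture of the
third powers of their one-body marginals, then measuring `B` or `C` on one further site increases
the average negative entropy. -/
lemma entropy_lt_of_not_approx {ι : Type*} [Fintype ι]
    {ω : ι → Matrix (Fin 3 → Fin d) (Fin 3 → Fin d) ℂ}
    (hω : ∀ x, (ω x).PosSemidef) (hs : ∀ x, PermInvariant (ω x)) (ht : ∑ x, (ω x).trace.re = 1)
    {A B C : Matrix (Fin d) (Fin d) ℂ} (hA : IsObservable A) (hB : IsObservable B)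
    (hC : IsObservable C) {ε : ℝ} (hε : 0 < ε)
    (h : ε < ‖(trip A B C * ∑ x, ω x).trace - ∑ x, ((ω x).trace.re : ℂ) *
      ((A * oneBodyState (ω x)).trace * (B * oneBodyState (ω x)).trace *
        (C * oneBodyState (ω x)).trace)‖) :
    ∑ x, homNegEntropy (measureLast 1 (ω x)) + ε ^ 2 / 32 <
      ∑ x, ∑ o, homNegEntropy (measureLast (effect B C o) (ω x)) := by
  have h1 : ε < ε / 2 * 1 + 16 / ε * (∑ x, ∑ o, homNegEntropy (measureLast (effect B C o) (ω x)) -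
      ∑ x, homNegEntropy (measureLast 1 (ω x))) := by
    rw [Matrix.mul_sum, trace_sum, ← Finset.sum_sub_distrib] at h
    refine h.trans_le ((norm_sum_le _ _).trans ((Finset.sum_le_sum fun x _ =>
      norm_trace_trip_sub_le (hω x) (hs x) hA hB hC hε).trans_eq ?_))
    rw [Finset.sum_add_distrib, ← Finset.mul_sum, ← Finset.mul_sum, ht, Finset.sum_sub_distrib]
  set D := ∑ x, ∑ o, homNegEntropy (measureLast (effect B C o) (ω x)) -
    ∑ x, homNegEntropy (measureLast 1 (ω x)) with hD
  have h2 : ε / 2 * ε < 16 / ε * D * ε := by gcongr; linarith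
  have h3 : 16 / ε * D * ε = 16 * D := by field_simp
  rw [h3] at h2
  nlinarith

/-- The measure-and-stop argument: as long as no mixture of product states approximates the
three-body marginal, measuring further sites increases a bounded entropy functional. -/
lemma exists_mixture (hd : d ≠ 0) {ε : ℝ} (hε : 0 < ε) (m : ℕ) :
    ∀ {ι : Type} [Fintype ι] (Γ : ι → Matrix (Fin (m + 3) → Fin d) (Fin (m + 3) → Fin d) ℂ),
      (∀ x, (Γ x).PosSemidef) → (∀ x, PermInvariant (Γ x)) → ∑ x, (Γ x).trace.re = 1 →
      2 * Real.log 2 ≤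
        ∑ x, homNegEntropy (measureLast 1 (marginal m (Γ x))) + (m + 1) * (ε ^ 2 / 32) →
      ∃ (κ : Type) (_ : Fintype κ) (w : κ → ℝ) (γ : κ → Matrix (Fin d) (Fin d) ℂ),
        (∀ y, 0 ≤ w y) ∧ ∑ y, w y = 1 ∧ (∀ y, (γ y).PosSemidef ∧ (γ y).trace = 1) ∧
        ∀ A B C : Matrix (Fin d) (Fin d) ℂ, IsObservable A → IsObservable B → IsObservable C →
          ‖(trip A B C * ∑ x, marginal m (Γ x)).trace - ∑ y, (w y : ℂ) *
            ((A * γ y).trace * (B * γ y).trace * (C * γ y).trace)‖ ≤ ε := by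
  induction m with
  | zero =>
    intro ι _ Γ hp hs ht hlog
    refine ⟨ι, inferInstance, fun x => (Γ x).trace.re, fun x => oneBodyState (Γ x),
      fun x => re_trace_nonneg (hp x), ht, fun x => ⟨posSemidef_oneBodyState (hp x),
        trace_oneBodyState hd (hp x)⟩, fun A B C hA hB hC => ?_⟩
    by_contra! h
    have h1 := entropy_lt_of_not_approx hp hs ht hA hB hC hε h
    have h2 : ∑ x, ∑ o, homNegEntropy (measureLast (effect B C o) (Γ x)) ≤
        ∑ x, ∑ o, (measureLast (effect B C o) (Γ x)).trace.re * (2 * Real.log 2) :=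
      Finset.sum_le_sum fun x _ => Finset.sum_le_sum fun o _ =>
        homNegEntropy_le (posSemidef_measureLast (posSemidef_effect hB hC o) (hp x))
    have h3 : ∑ x, ∑ o, (measureLast (effect B C o) (Γ x)).trace.re * (2 * Real.log 2) =
        2 * Real.log 2 := by
      simp only [← Finset.sum_mul, ← Complex.re_sum, ← trace_sum, sum_measureLast, sum_effect,
        trace_measureLast_one]
      rw [trace_sum, Complex.re_sum, ht, one_mul]
    simp only [marginal, LinearMap.id_apply] at hlog
    push_cast at hlog
    linarith
  | succ m ih =>
    intro ι _ Γ hp hs ht hlog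
    by_cases hgood : ∀ A B C : Matrix (Fin d) (Fin d) ℂ,
        IsObservable A → IsObservable B → IsObservable C →
          ‖(trip A B C * ∑ x, marginal (m + 1) (Γ x)).trace -
            ∑ x, ((marginal (m + 1) (Γ x)).trace.re : ℂ) *
              ((A * oneBodyState (marginal (m + 1) (Γ x))).trace *
              (B * oneBodyState (marginal (m + 1) (Γ x))).trace *
              (C * oneBodyState (marginal (m + 1) (Γ x))).trace)‖ ≤ ε
    · refine ⟨ι, inferInstance, fun x => (marginal (m + 1) (Γ x)).trace.re,
        fun x => oneBodyState (marginal (m + 1) (Γ x)),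
        fun x => re_trace_nonneg (posSemidef_marginal (hp x)), ?_,
        fun x => ⟨posSemidef_oneBodyState (posSemidef_marginal (hp x)),
          trace_oneBodyState hd (posSemidef_marginal (hp x))⟩, hgood⟩
      simpa only [trace_marginal] using ht
    · push Not at hgood
      obtain ⟨A, B, C, hA, hB, hC, h⟩ := hgood
      have h1 := entropy_lt_of_not_approx (fun x => posSemidef_marginal (hp x))
        (fun x => (hs x).marginal) (by simpa only [trace_marginal] using ht) hA hB hC hε h
      obtain ⟨κ, i, w, γ, hw, hw1, hγ, hmain⟩ := ih
        (fun p : ι × (Bool × Bool) => measureLast (effect B C p.2) (Γ p.1))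
        (fun p => posSemidef_measureLast (posSemidef_effect hB hC p.2) (hp p.1))
        (fun p => (hs p.1).measureLast)
        (by
          rw [Fintype.sum_prod_type]
          simp only [← Complex.re_sum, ← trace_sum, sum_measureLast, sum_effect]
          rw [trace_sum, Complex.re_sum]
          simpa only [trace_measureLast_one] using ht)
        (by
          rw [Fintype.sum_prod_type]
          simp only [measureLast_marginal_measureLast _ (hs _)]
          push_cast at hlog
          linarith)
      refine ⟨κ, i, w, γ, hw, hw1, hγ, ?_⟩
      rw [Fintype.sum_prod_type] at hmain
      simpa only [marginal_succ, ← map_sum, sum_measureLast, sum_effect] using hmain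

lemma exists_isObservable_smul {A : Matrix (Fin d) (Fin d) ℂ} (hA : A.IsHermitian) :
    ∃ A', IsObservable A' ∧ A = (l2OpNorm A : ℂ) • A' := by
  have ha : 0 ≤ l2OpNorm A := norm_nonneg _
  set a := l2OpNorm A with ha'
  have hbound : ∀ x : Fin d → ℂ, |(star x ⬝ᵥ (A *ᵥ x)).re| ≤ a * (star x ⬝ᵥ x).re := by
    intro x
    have h1 : star x ⬝ᵥ (A *ᵥ x) = inner ℂ (WithLp.toLp 2 x)
        (LinearMap.toContinuousLinearMap (toEuclideanLin A) (WithLp.toLp 2 x)) := by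
      rw [dotProduct_comm]
      rfl
    have h2 : (star x ⬝ᵥ x).re = ‖WithLp.toLp 2 x‖ ^ 2 := by
      rw [dotProduct_comm, ← inner_self_eq_norm_sq (𝕜 := ℂ)]
      rfl
    rw [h1, h2]
    calc _ ≤ _ := Complex.abs_re_le_norm _
      _ ≤ _ := norm_inner_le_norm _ _
      _ ≤ ‖WithLp.toLp 2 x‖ * (a * ‖WithLp.toLp 2 x‖) := by
          gcongr
          exact ContinuousLinearMap.le_opNorm _ _
      _ = _ := by ring
  by_cases h0 : a = 0
  · refine ⟨1, isObservable_one, ?_⟩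
    have : toEuclideanLin A = 0 := by
      have := norm_eq_zero.1 (ha'.symm.trans h0)
      simpa using this
    simpa [h0] using this
  · have ha0 : 0 < a := lt_of_le_of_ne ha (Ne.symm h0)
    have hH : (a⁻¹ • A).IsHermitian := by
      rw [IsHermitian, conjTranspose_smul, hA.eq, star_trivial]
    have hquad : ∀ x : Fin d → ℂ, (star x ⬝ᵥ ((a⁻¹ • A) *ᵥ x)).re =
        a⁻¹ * (star x ⬝ᵥ (A *ᵥ x)).re := fun x => by
      rw [smul_mulVec, dotProduct_smul, Complex.smul_re, smul_eq_mul]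
    have hq : ∀ x : Fin d → ℂ, |a⁻¹ * (star x ⬝ᵥ (A *ᵥ x)).re| ≤ (star x ⬝ᵥ x).re := fun x => by
      rw [abs_mul, abs_of_pos (inv_pos.2 ha0), inv_mul_le_iff₀ ha0]
      exact hbound x
    refine ⟨a⁻¹ • A, ⟨hH, ?_, ?_⟩, ?_⟩
    · have h1 : (1 - a⁻¹ • A).IsHermitian := isHermitian_one.sub hH
      refine PosSemidef.of_dotProduct_mulVec_nonneg h1 fun x => ?_
      rw [Complex.nonneg_iff]
      refine ⟨?_, (h1.im_star_dotProduct_mulVec_self x).symm⟩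
      rw [sub_mulVec, one_mulVec, dotProduct_sub, Complex.sub_re, hquad]
      linarith [(abs_le.1 (hq x)).2]
    · have h1 : (1 + a⁻¹ • A).IsHermitian := isHermitian_one.add hH
      refine PosSemidef.of_dotProduct_mulVec_nonneg h1 fun x => ?_
      rw [Complex.nonneg_iff]
      refine ⟨?_, (h1.im_star_dotProduct_mulVec_self x).symm⟩
      rw [add_mulVec, one_mulVec, dotProduct_add, Complex.add_re, hquad]
      linarith [(abs_le.1 (hq x)).1]
    · rw [Complex.coe_smul, smul_smul, mul_inv_cancel₀ h0, one_smul]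

lemma trip_smul (a b c : ℂ) (A B C : Matrix (Fin d) (Fin d) ℂ) :
    trip (a • A) (b • B) (c • C) = (a * b * c) • trip A B C := by
  ext x y
  simp [trip]
  ring

lemma trip_eq_prod (M : Fin 3 → Matrix (Fin d) (Fin d) ℂ) (x y : Fin 3 → Fin d) :
    trip (M 0) (M 1) (M 2) x y = ∏ i, M i (x i) (y i) := by
  rw [Fin.prod_univ_three]
  rfl

lemma trip_mul_trip (A B C A' B' C' : Matrix (Fin d) (Fin d) ℂ) :
    trip A B C * trip A' B' C' = trip (A * A') (B * B') (C * C') := by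
  ext x y
  have h1 := trip_eq_prod ![A * A', B * B', C * C'] x y
  have h2 := fun z => trip_eq_prod ![A, B, C] x z
  have h3 := fun z => trip_eq_prod ![A', B', C'] z y
  have h4 : ∀ i, (![A * A', B * B', C * C'] : Fin 3 → Matrix (Fin d) (Fin d) ℂ) i =
      ![A, B, C] i * ![A', B', C'] i := by
    intro i
    fin_cases i <;> rfl
  refine Eq.trans ?_ h1.symm
  simp only [h4, mul_apply]
  rw [Fintype.prod_sum]
  refine Finset.sum_congr rfl fun z _ => ?_
  rw [Finset.prod_mul_distrib]
  exact congrArg₂ (· * ·) (h2 z) (h3 z)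

lemma trace_trip (A B C : Matrix (Fin d) (Fin d) ℂ) :
    (trip A B C).trace = A.trace * B.trace * C.trace := by
  have h := fun x => trip_eq_prod ![A, B, C] x x
  refine (Finset.sum_congr rfl fun x _ => h x).trans ?_
  have h2 := Fintype.prod_sum fun i u => (![A, B, C] : Fin 3 → Matrix (Fin d) (Fin d) ℂ) i u u
  refine h2.symm.trans ?_
  rw [Fin.prod_univ_three]
  rfl

section AtomicMeasure

variable {α κ : Type*} [MeasurableSpace α] [Fintype κ] {w : κ → ℝ} {γ : κ → α}

/-- The finitely supported measure with weights `w` at the atoms `γ`. -/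
def atomicMeasure (w : κ → ℝ) (γ : κ → α) : Measure α :=
  ∑ y, ENNReal.ofReal (w y) • Measure.dirac (γ y)

lemma isProbabilityMeasure_atomicMeasure (hw : ∀ y, 0 ≤ w y) (hw1 : ∑ y, w y = 1) :
    IsProbabilityMeasure (atomicMeasure w γ) := by
  refine ⟨?_⟩
  simp only [atomicMeasure, Measure.coe_finsetSum, Finset.sum_apply, Measure.smul_apply,
    measure_univ, smul_eq_mul, mul_one]
  rw [← ENNReal.ofReal_sum_of_nonneg fun y _ => hw y, hw1, ENNReal.ofReal_one]

variable [MeasurableSingletonClass α]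

lemma ae_atomicMeasure {p : α → Prop} (h : ∀ y, p (γ y)) : ∀ᵐ g ∂atomicMeasure w γ, p g := by
  rw [ae_iff, atomicMeasure, Measure.coe_finsetSum, Finset.sum_apply]
  refine Finset.sum_eq_zero fun y _ => ?_
  rw [Measure.smul_apply, Measure.dirac_apply, Set.indicator_of_notMem (by simpa using h y),
    smul_zero]

lemma integral_atomicMeasure (hw : ∀ y, 0 ≤ w y) (f : α → ℂ) :
    ∫ g, f g ∂atomicMeasure w γ = ∑ y, (w y : ℂ) * f (γ y) := by
  rw [atomicMeasure, integral_finsetSum_measure]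
  · refine Finset.sum_congr rfl fun y _ => ?_
    rw [integral_smul_measure, integral_dirac, ENNReal.toReal_ofReal (hw y), Complex.real_smul]
  · exact fun y _ => (integrable_dirac enorm_lt_top).smul_measure ENNReal.ofReal_ne_top

end AtomicMeasure

/-- The three-body marginal of a permutation-invariant state is close to a finite mixture of product
states, tested on products of observables. -/
lemma exists_mixture_of_state (hd : 2 ≤ d)
    {Γ : Matrix (Fin (m + 3) → Fin d) (Fin (m + 3) → Fin d) ℂ}
    (hp : Γ.PosSemidef) (ht : Γ.trace = 1) (hs : PermInvariant Γ) :
    ∃ (κ : Type) (_ : Fintype κ) (w : κ → ℝ) (γ : κ → Matrix (Fin d) (Fin d) ℂ),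
      (∀ y, 0 ≤ w y) ∧ ∑ y, w y = 1 ∧ (∀ y, (γ y).PosSemidef ∧ (γ y).trace = 1) ∧
      ∀ A B C : Matrix (Fin d) (Fin d) ℂ, IsObservable A → IsObservable B → IsObservable C →
        ‖(trip A B C * marginal m Γ).trace - ∑ y, (w y : ℂ) *
          ((A * γ y).trace * (B * γ y).trace * (C * γ y).trace)‖ ≤
        24 * √(Real.log d / (m + 3 : ℕ)) := by
  have hlog2 : 0 < Real.log 2 := Real.log_pos (by norm_num)
  have hlog : Real.log 2 ≤ Real.log d := Real.log_le_log (by norm_num) (by exact_mod_cast hd)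
  have hpos : 0 < Real.log d / (m + 3 : ℕ) := by
    have := hlog2.trans_le hlog
    positivity
  obtain ⟨κ, i, w, γ, hw, hw1, hγ, h⟩ := exists_mixture (d := d) (by omega)
    (ε := 24 * √(Real.log d / (m + 3 : ℕ))) (by positivity) m (fun _ : Unit => Γ)
    (fun _ => hp) (fun _ => hs) (by simp [ht]) (by
      have h1 := le_homNegEntropy
        (posSemidef_measureLast PosSemidef.one (posSemidef_marginal (m := m) hp))
      rw [trace_measureLast_one, trace_marginal, ht] at h1
      rw [mul_pow, Real.sq_sqrt hpos.le]
      simp only [Fintype.card_fun, Fintype.card_fin, Nat.cast_pow, Real.log_pow, Complex.one_re,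
        one_mul, Nat.cast_ofNat] at h1
      simp only [Finset.univ_unique, Finset.sum_singleton]
      have h2 : 6 * Real.log d ≤ (m + 1) * (24 ^ 2 * (Real.log d / (m + 3 : ℕ)) / 32) := by
        rw [show ((m : ℝ) + 1) * (24 ^ 2 * (Real.log d / (m + 3 : ℕ)) / 32) =
          18 * (m + 1) * Real.log d / (m + 3) by push_cast; ring, le_div_iff₀ (by positivity)]
        have : 0 ≤ (m : ℝ) * Real.log d := by positivity
        nlinarith
      linarith)
  refine ⟨κ, i, w, γ, hw, hw1, hγ, ?_⟩
  simpa only [Finset.univ_unique, Finset.sum_singleton] using h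

end DeFinetti

end QuantumDeFinetti

/-- **quantitative quantum de Finetti theorem.** -/
theorem quantitative_quantum_de_finetti :
    ∃ C' : ℝ, 0 < C' ∧ ∀ (d K : ℕ), 2 ≤ d → ∀ hK : 3 ≤ K,
      ∀ Γ : Matrix (Fin K → Fin d) (Fin K → Fin d) ℂ,
        Γ.PosSemidef → Γ.trace = 1 →
        (∀ σ : Equiv.Perm (Fin K), ∀ x y : Fin K → Fin d, Γ (x ∘ σ) (y ∘ σ) = Γ x y) →
        ∃ μ : Measure (Fin d → Fin d → ℂ), IsProbabilityMeasure μ ∧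
          (∀ᵐ γ ∂μ, (Matrix.of γ).PosSemidef ∧ (Matrix.of γ).trace = 1) ∧
          ∀ A B C : Matrix (Fin d) (Fin d) ℂ,
            A.IsHermitian → B.IsHermitian → C.IsHermitian →
            ‖Matrix.trace (trip A B C *
                (red3 hK Γ - Matrix.of fun a b =>
                  ∫ γ, trip (Matrix.of γ) (Matrix.of γ) (Matrix.of γ) a b ∂μ))‖
              ≤ C' * Real.sqrt (Real.log d / K) *
                  (l2OpNorm A * l2OpNorm B * l2OpNorm C) := by
  open QuantumDeFinetti in
  refine ⟨24, by norm_num, fun d K hd hK Γ hp ht hs => ?_⟩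
  obtain ⟨m, rfl⟩ : ∃ m, K = m + 3 := ⟨K - 3, by omega⟩
  obtain ⟨κ, _, w, γ, hw, hw1, hγ, h⟩ := exists_mixture_of_state hd hp ht hs
  refine ⟨atomicMeasure w γ, isProbabilityMeasure_atomicMeasure hw hw1, ae_atomicMeasure hγ,
    fun A B C hA hB hC => ?_⟩
  have hint : (Matrix.of fun a b => ∫ g, trip (Matrix.of g) (Matrix.of g) (Matrix.of g) a b
      ∂atomicMeasure (α := Fin d → Fin d → ℂ) w γ) =
        ∑ y, (w y : ℂ) • trip (γ y) (γ y) (γ y) := by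
    ext a b
    refine (integral_atomicMeasure (α := Fin d → Fin d → ℂ) hw _).trans ?_
    rw [Matrix.sum_apply]
    rfl
  obtain ⟨A', hA', eA⟩ := exists_isObservable_smul hA
  obtain ⟨B', hB', eB⟩ := exists_isObservable_smul hB
  obtain ⟨C', hC', eC⟩ := exists_isObservable_smul hC
  have hsplit : (trip A' B' C' * (red3 hK Γ - ∑ y, (w y : ℂ) • trip (γ y) (γ y) (γ y))).trace =
      (trip A' B' C' * marginal m Γ).trace -
        ∑ y, (w y : ℂ) * ((A' * γ y).trace * (B' * γ y).trace * (C' * γ y).trace) := by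
    simp only [red3_eq_marginal, Matrix.mul_sub, Matrix.trace_sub, Matrix.mul_sum,
      Matrix.trace_sum, Matrix.mul_smul, Matrix.trace_smul, trip_mul_trip, trace_trip, smul_eq_mul]
  have hnorm : ‖(l2OpNorm A : ℂ) * l2OpNorm B * l2OpNorm C‖ =
      l2OpNorm A * l2OpNorm B * l2OpNorm C := by
    have hn : ∀ D : Matrix (Fin d) (Fin d) ℂ, 0 ≤ l2OpNorm D := fun D => norm_nonneg _
    rw [← Complex.ofReal_mul, ← Complex.ofReal_mul, Complex.norm_real, Real.norm_of_nonneg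
      (mul_nonneg (mul_nonneg (hn A) (hn B)) (hn C))]
  have hfactor : trip A B C = ((l2OpNorm A : ℂ) * l2OpNorm B * l2OpNorm C) • trip A' B' C' := by
    rw [← trip_smul, ← eA, ← eB, ← eC]
  rw [hint, hfactor, Matrix.smul_mul, Matrix.trace_smul, hsplit, smul_eq_mul, norm_mul, hnorm,
    mul_comm]
  have hn : 0 ≤ l2OpNorm A * l2OpNorm B * l2OpNorm C := hnorm ▸ norm_nonneg _
  gcongr
  exact h A' B' C' hA' hB' hC'

end
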